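/- Let d ≥ 2 be an integer, let ρ : ℝ^d → (0,∞) be continuous, let A = (a_ij) be a continuous map from ℝ^d into the symmetric positive semidefinite d×d real matrices and let C = (c_ij) be a continuous map from ℝ^d into the antisymmetric d×d real matrices. Suppose there are constants θ, M > 0 such that ⟨ρ(x)A(x)ξ, ξ⟩ ≥ θ‖ξ‖² for all x, ξ ∈ ℝ^d and max_{i,j} |ρ(x)c_ij(x)| ≤ M for all x ∈ ℝ^d. Then for all f, g ∈ C_c^∞(ℝ^d), | ∫_{ℝ^d} ⟨C∇f, ∇g⟩ ρ dx | ≤ (2dM/θ) · ( (1/2)∫_{ℝ^d} ⟨A∇f, ∇f⟩ ρ dx )^{1/2} · ( (1/2)∫_{ℝ^d} ⟨A∇g, ∇g⟩ ρ dx )^{1/2}. -/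

import Mathlib

open MeasureTheory Real
open scoped ENNReal

noncomputable section

/-- `⟨M v, w⟩` for a `d × d` matrix `M` and vectors `v, w ∈ ℝ^d`. -/
def mdot {d : ℕ} (M : Matrix (Fin d) (Fin d) ℝ) (v w : EuclideanSpace ℝ (Fin d)) : ℝ :=
  ∑ i, ∑ j, M i j * v j * w i

/-- Comparison of the `ℓ¹` and Euclidean norms on `ℝ^d`. -/
theorem sum_abs_le_sqrt_mul_norm {d : ℕ} (v : EuclideanSpace ℝ (Fin d)) :
    ∑ i, |v i| ≤ √d * ‖v‖ := by
  refine le_of_sq_le_sq ?_ (by positivity)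
  rw [mul_pow, Real.sq_sqrt (Nat.cast_nonneg d), EuclideanSpace.real_norm_sq_eq]
  simpa using sq_sum_le_card_mul_sum_sq (s := Finset.univ) (f := fun i => |v i|)

/-- A bilinear form whose coefficients are bounded by `M` is bounded by `d * M`. -/
theorem abs_mdot_mul_le {d : ℕ} {B : Matrix (Fin d) (Fin d) ℝ} {r M : ℝ} (hM : 0 ≤ M)
    (hB : ∀ i j, |r * B i j| ≤ M) (v w : EuclideanSpace ℝ (Fin d)) :
    |mdot B v w * r| ≤ d * M * (‖v‖ * ‖w‖) := by
  calc |mdot B v w * r| = |∑ i, ∑ j, (r * B i j) * v j * w i| := by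
        simp only [mdot, Finset.sum_mul]
        refine congrArg _ (Finset.sum_congr rfl fun i _ => Finset.sum_congr rfl fun j _ => ?_)
        ring
    _ ≤ ∑ i, ∑ j, M * |v j| * |w i| := by
        refine (Finset.abs_sum_le_sum_abs _ _).trans (Finset.sum_le_sum fun i _ => ?_)
        refine (Finset.abs_sum_le_sum_abs _ _).trans (Finset.sum_le_sum fun j _ => ?_)
        rw [abs_mul, abs_mul]
        gcongr
        exact hB i j
    _ = M * ((∑ j, |v j|) * ∑ i, |w i|) := by
        simp only [← Finset.sum_mul, ← Finset.mul_sum]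
        ring
    _ ≤ M * ((√d * ‖v‖) * (√d * ‖w‖)) := by
        gcongr <;> exact sum_abs_le_sqrt_mul_norm _
    _ = d * M * (‖v‖ * ‖w‖) := by
        linear_combination M * ‖v‖ * ‖w‖ * Real.mul_self_sqrt (Nat.cast_nonneg d)

/-- The Cauchy–Schwarz inequality for continuous compactly supported vector fields. -/
theorem integral_norm_mul_norm_le {d : ℕ}
    {u v : EuclideanSpace ℝ (Fin d) → EuclideanSpace ℝ (Fin d)}
    (hu : Continuous u) (hus : HasCompactSupport u) (hv : Continuous v)
    (hvs : HasCompactSupport v) :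
    ∫ x, ‖u x‖ * ‖v x‖ ≤ √(∫ x, ‖u x‖ ^ 2) * √(∫ x, ‖v x‖ ^ 2) := by
  have h := integral_mul_le_Lp_mul_Lq_of_nonneg (μ := volume) Real.HolderConjugate.two_two
    (Filter.Eventually.of_forall fun x => norm_nonneg (u x))
    (Filter.Eventually.of_forall fun x => norm_nonneg (v x))
    (hu.norm.memLp_of_hasCompactSupport hus.norm) (hv.norm.memLp_of_hasCompactSupport hvs.norm)
  simpa only [Real.sqrt_eq_rpow, Real.rpow_two] using h

theorem continuous_gradient {d : ℕ} {f : EuclideanSpace ℝ (Fin d) → ℝ}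
    (hf : ContDiff ℝ (⊤ : ℕ∞) f) : Continuous (gradient f) :=
  (InnerProductSpace.toDual ℝ _).symm.continuous.comp (hf.continuous_fderiv (by simp))

theorem hasCompactSupport_gradient {d : ℕ} {f : EuclideanSpace ℝ (Fin d) → ℝ}
    (hf : HasCompactSupport f) : HasCompactSupport (gradient f) := by
  refine (hf.fderiv ℝ).mono fun x hx hfx => hx ?_
  rw [gradient, hfx, map_zero]

/-- A uniformly elliptic weighted form dominates the `L²` norm of a compactly supported field. -/
theorem integral_norm_sq_le {d : ℕ} {ρ : EuclideanSpace ℝ (Fin d) → ℝ} (hρ : Continuous ρ)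
    {A : EuclideanSpace ℝ (Fin d) → Matrix (Fin d) (Fin d) ℝ}
    (hA : ∀ i j, Continuous fun x => A x i j) {θ : ℝ} (hθ : 0 < θ)
    (hell : ∀ x ξ : EuclideanSpace ℝ (Fin d), θ * ‖ξ‖ ^ 2 ≤ ρ x * mdot (A x) ξ ξ)
    {u : EuclideanSpace ℝ (Fin d) → EuclideanSpace ℝ (Fin d)}
    (hu : Continuous u) (hus : HasCompactSupport u) :
    ∫ x, ‖u x‖ ^ 2 ≤ 2 / θ * ((1 / 2) * ∫ x, mdot (A x) (u x) (u x) * ρ x) := by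
  have hsq : Integrable fun x => ‖u x‖ ^ 2 :=
    (hu.norm.pow 2).integrable_of_hasCompactSupport
      (hus.mono fun x hx hux => hx (by simp [hux]))
  have hform : Integrable fun x => mdot (A x) (u x) (u x) * ρ x := by
    refine Continuous.integrable_of_hasCompactSupport ?_ ?_
    · unfold mdot
      fun_prop
    · refine hus.mono fun x hx hux => hx ?_
      simp [mdot, hux]
  have h : θ * ∫ x, ‖u x‖ ^ 2 ≤ ∫ x, mdot (A x) (u x) (u x) * ρ x := by
    rw [← integral_const_mul]
    refine integral_mono (hsq.const_mul θ) hform fun x => ?_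
    simpa only [mul_comm (ρ x)] using hell x (u x)
  calc ∫ x, ‖u x‖ ^ 2 ≤ (∫ x, mdot (A x) (u x) (u x) * ρ x) / θ := by
        rwa [le_div_iff₀' hθ]
    _ = _ := by ring

/-- The strong sector condition estimate from the proof of Theorem 4.3:
`|∫ ⟨C∇f,∇g⟩ ρ dx| ≤ (2dM/θ) ((1/2)∫ ⟨A∇f,∇f⟩ ρ dx)^{1/2} ((1/2)∫ ⟨A∇g,∇g⟩ ρ dx)^{1/2}`. -/
theorem stmt11 {d : ℕ} (hd : 2 ≤ d)
    (ρ : EuclideanSpace ℝ (Fin d) → ℝ) (hρc : Continuous ρ) (hρ : ∀ x, 0 < ρ x)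
    (A C : EuclideanSpace ℝ (Fin d) → Matrix (Fin d) (Fin d) ℝ)
    (hAc : ∀ i j, Continuous fun x => A x i j)
    (hAsymm : ∀ x, (A x).IsSymm) (hApsd : ∀ x, (A x).PosSemidef)
    (hCc : ∀ i j, Continuous fun x => C x i j)
    (hCanti : ∀ x, (C x).transpose = -(C x))
    (θ M : ℝ) (hθ : 0 < θ) (hM : 0 < M)
    (hell : ∀ (x ξ : EuclideanSpace ℝ (Fin d)), θ * ‖ξ‖ ^ 2 ≤ ρ x * mdot (A x) ξ ξ)
    (hCb : ∀ (x : EuclideanSpace ℝ (Fin d)) (i j : Fin d), |ρ x * C x i j| ≤ M) :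
    ∀ f g : EuclideanSpace ℝ (Fin d) → ℝ,
      ContDiff ℝ (⊤ : ℕ∞) f → HasCompactSupport f → ContDiff ℝ (⊤ : ℕ∞) g → HasCompactSupport g →
      |∫ x, mdot (C x) (gradient f x) (gradient g x) * ρ x|
        ≤ (2 * d * M / θ)
          * Real.sqrt ((1/2) * ∫ x, mdot (A x) (gradient f x) (gradient f x) * ρ x)
          * Real.sqrt ((1/2) * ∫ x, mdot (A x) (gradient g x) (gradient g x) * ρ x) := by
  intro f g hf hfs hg hgs
  have hu := continuous_gradient hf
  have hv := continuous_gradient hg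
  have hus := hasCompactSupport_gradient hfs
  have hvs := hasCompactSupport_gradient hgs
  have hprod : Integrable fun x => ‖gradient f x‖ * ‖gradient g x‖ :=
    (hu.norm.mul hv.norm).integrable_of_hasCompactSupport hus.norm.mul_right
  have hθ' : 0 ≤ 2 / θ := by positivity
  calc |∫ x, mdot (C x) (gradient f x) (gradient g x) * ρ x|
      ≤ ∫ x, d * M * (‖gradient f x‖ * ‖gradient g x‖) := by
        rw [← Real.norm_eq_abs]
        exact norm_integral_le_of_norm_le (hprod.const_mul _)
          (Filter.Eventually.of_forall fun x => abs_mdot_mul_le hM.le (hCb x) _ _)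
    _ = d * M * ∫ x, ‖gradient f x‖ * ‖gradient g x‖ := integral_const_mul _ _
    _ ≤ d * M * (√(∫ x, ‖gradient f x‖ ^ 2) * √(∫ x, ‖gradient g x‖ ^ 2)) := by
        gcongr
        exact integral_norm_mul_norm_le hu hus hv hvs
    _ ≤ d * M * (√(2 / θ * ((1 / 2) * ∫ x, mdot (A x) (gradient f x) (gradient f x) * ρ x))
          * √(2 / θ * ((1 / 2) * ∫ x, mdot (A x) (gradient g x) (gradient g x) * ρ x))) := by
        gcongr
        · exact integral_norm_sq_le hρc hAc hθ hell hu hus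
        · exact integral_norm_sq_le hρc hAc hθ hell hv hvs
    _ = _ := by
        rw [Real.sqrt_mul hθ', Real.sqrt_mul hθ', mul_mul_mul_comm (√(2 / θ)),
          Real.mul_self_sqrt hθ']
        ring
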